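/- Let θ ∈ (0,1), p ∈ (1,2], σ ≥ 0, and let δ_1, …, δ_k be R^d-valued random variables with E[δ_t | δ_1,…,δ_{t−1}] = 0 and E[‖δ_t‖^p] ≤ σ^p for each t. Then E[‖∑_{t=1}^k θ^{k−t} δ_t‖] ≤ 2^{2/p−1}·σ/(1−θ^p)^{1/p}. -/

import Mathlib

open MeasureTheory
open scoped ENNReal NNReal

lemma wm_tangent {u v r : ℝ} (hu : 0 ≤ u) (hv : 0 < v) (hr0 : 0 ≤ r) (hr1 : r ≤ 1) :
    u ^ r ≤ v ^ r + r * v ^ (r - 1) * (u - v) := by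
  have h := rpow_one_add_le_one_add_mul_self (s := u / v - 1) (p := r)
    (by have := div_nonneg hu hv.le; linarith) hr0 hr1
  have e : 1 + (u / v - 1) = u / v := by ring
  rw [e, Real.div_rpow hu hv.le, div_le_iff₀ (Real.rpow_pos_of_pos hv r)] at h
  rw [Real.rpow_sub_one hv.ne']
  refine h.trans (le_of_eq ?_)
  field_simp

/-- concavity: `u^q + v^q ≤ 2^(1-q) (u+v)^q`. -/
lemma wm_conc {u v q : ℝ} (hu : 0 ≤ u) (hv : 0 ≤ v) (hq0 : 0 ≤ q) (hq1 : q ≤ 1) :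
    u ^ q + v ^ q ≤ 2 ^ (1 - q) * (u + v) ^ q := by
  have h := (Real.concaveOn_rpow hq0 hq1).2 (Set.mem_Ici.2 hu) (Set.mem_Ici.2 hv)
    (by norm_num : (0:ℝ) ≤ 1 / 2) (by norm_num : (0:ℝ) ≤ 1 / 2) (by norm_num)
  simp only [smul_eq_mul] at h
  have e : 1 / 2 * u + 1 / 2 * v = (u + v) / 2 := by ring
  rw [e, Real.div_rpow (by positivity) (by norm_num)] at h
  rw [Real.rpow_sub (by norm_num), Real.rpow_one]
  have e2 : (2:ℝ) / 2 ^ q * (u + v) ^ q = 2 * ((u + v) ^ q / 2 ^ q) := by ring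
  rw [e2]; linarith

lemma wm_scalar {a b p : ℝ} (ha : 0 < a) (hab : a ≤ b) (hp1 : 1 < p) (hp2 : p ≤ 2) :
    (b - a) ^ p + p * a ^ (p - 1) * b ≤ a ^ p + 2 ^ (2 - p) * b ^ p := by
  let H : ℝ → ℝ := fun s => 2 ^ (2 - p) * s ^ p - (s - a) ^ p - p * a ^ (p - 1) * s
  have hd : ∀ s, HasDerivAt H (2 ^ (2 - p) * (p * s ^ (p - 1)) - p * (s - a) ^ (p - 1)
      - p * a ^ (p - 1)) s := by
    intro s
    have h1 := (Real.hasDerivAt_rpow_const (x := s) (p := p) (Or.inr hp1.le)).const_mul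
      ((2:ℝ) ^ (2 - p))
    have h2 : HasDerivAt (fun s : ℝ => (s - a) ^ p) (p * (s - a) ^ (p - 1)) s := by
      simpa [mul_comm] using
        ((hasDerivAt_id s).sub_const a).rpow_const (p := p) (Or.inr hp1.le)
    have h3 := (hasDerivAt_id s).const_mul (p * a ^ (p - 1))
    rw [mul_one] at h3
    exact (h1.sub h2).sub h3
  have hm : MonotoneOn H (Set.Icc a b) := by
    apply monotoneOn_of_deriv_nonneg (convex_Icc a b)
    · exact fun s _ => (hd s).continuousAt.continuousWithinAt
    · exact fun s _ => (hd s).differentiableAt.differentiableWithinAt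
    · intro s hs
      rw [interior_Icc] at hs
      rw [(hd s).deriv]
      have h := wm_conc (u := s - a) (v := a) (q := p - 1) (by linarith [hs.1]) ha.le
        (by linarith) (by linarith)
      rw [sub_add_cancel, show 1 - (p - 1) = 2 - p by ring] at h
      nlinarith
  have h := hm ⟨le_refl a, hab⟩ ⟨hab, le_refl b⟩ hab
  simp only [H, sub_self] at h
  rw [Real.zero_rpow (by linarith)] at h
  have e : a ^ (p - 1) * a = a ^ p := by
    rw [← Real.rpow_add_one ha.ne']; congr 1; ring
  have e' : p * a ^ (p - 1) * a = p * a ^ p := by rw [← e]; ring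
  rw [e'] at h
  have h2 : (1:ℝ) ≤ 2 ^ (2 - p) := Real.one_le_rpow (by norm_num) (by linarith)
  have h3 : 0 < a ^ p := Real.rpow_pos_of_pos ha p
  nlinarith

lemma wm_pointwise {E : Type*} [NormedAddCommGroup E] [InnerProductSpace ℝ E] (x y : E)
    {p : ℝ} (hp1 : 1 < p) (hp2 : p ≤ 2) :
    ‖x + y‖ ^ p ≤ ‖x‖ ^ p + p * inner ℝ (‖x‖ ^ (p - 2) • x) y + 2 ^ (2 - p) * ‖y‖ ^ p := by
  have hc : (1:ℝ) ≤ 2 ^ (2 - p) := Real.one_le_rpow (by norm_num) (by linarith)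
  rw [real_inner_smul_left]
  rcases eq_or_ne x 0 with rfl | hx
  · have : 0 ≤ ‖y‖ ^ p := by positivity
    simp only [zero_add, norm_zero, inner_zero_left, mul_zero, add_zero]
    rw [Real.zero_rpow (by linarith)]
    nlinarith
  rcases eq_or_ne y 0 with rfl | hy
  · simp only [add_zero, norm_zero, inner_zero_right, mul_zero]
    rw [Real.zero_rpow (by linarith)]; simp
  have ha : 0 < ‖x‖ := norm_pos_iff.2 hx
  have hb : 0 < ‖y‖ := norm_pos_iff.2 hy
  have hi := (abs_le.1 (abs_real_inner_le_norm x y)).1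
  have hsq := norm_add_sq_real x y
  have key : ∀ z : ℝ, 0 ≤ z → (z ^ 2) ^ (p / 2) = z ^ p := fun z hz => by
    rw [← Real.rpow_natCast, ← Real.rpow_mul hz]; congr 1; push_cast; ring
  have key2 : ∀ z : ℝ, 0 ≤ z → (z ^ 2) ^ (p / 2 - 1) = z ^ (p - 2) := fun z hz => by
    rw [← Real.rpow_natCast, ← Real.rpow_mul hz]; congr 1; push_cast; ring
  have T : ∀ z : ℝ, 0 < z → ‖x + y‖ ^ p ≤ z ^ p + p / 2 * z ^ (p - 2) *
      (‖x‖ ^ 2 + 2 * inner ℝ x y + ‖y‖ ^ 2 - z ^ 2) := fun z hz => by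
    have h := wm_tangent (u := ‖x + y‖ ^ 2) (v := z ^ 2) (r := p / 2) (by positivity)
      (by positivity) (by linarith) (by linarith)
    rwa [key _ (norm_nonneg _), key _ hz.le, key2 _ hz.le, hsq] at h
  generalize inner ℝ x y = i at *
  generalize ‖x + y‖ = n at *
  generalize ‖x‖ = a at *
  generalize ‖y‖ = b at *
  rcases le_or_gt b (2 * a) with hab | hab
  · have h := T a ha
    have h1 : a ^ (p - 2) ≤ (b / 2) ^ (p - 2) :=
      Real.rpow_le_rpow_of_nonpos (by positivity) (by linarith) (by linarith)
    have h2 : (b / 2) ^ (p - 2) * b ^ 2 = 2 ^ (2 - p) * b ^ p := by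
      rw [Real.div_rpow hb.le (by norm_num), show (2:ℝ) - p = -(p - 2) by ring,
        Real.rpow_neg (by norm_num), show b ^ p = b ^ (p - 2) * b ^ 2 by
          rw [← Real.rpow_natCast, ← Real.rpow_add hb]; congr 1; push_cast; ring]
      ring
    have h3 : a ^ (p - 2) * b ^ 2 ≤ 2 ^ (2 - p) * b ^ p := by
      rw [← h2]; gcongr
    have h4 : 0 ≤ a ^ (p - 2) * b ^ 2 := by positivity
    nlinarith
  · have h := T (b - a) (by linarith)
    have h1 : (b - a) ^ (p - 2) ≤ a ^ (p - 2) :=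
      Real.rpow_le_rpow_of_nonpos (by positivity) (by linarith) (by linarith)
    have h2 : (b - a) ^ (p - 2) * (i + a * b) ≤ a ^ (p - 2) * (i + a * b) :=
      mul_le_mul_of_nonneg_right h1 (by linarith)
    have h3 := wm_scalar ha (by linarith : a ≤ b) hp1 hp2
    have h4 : a ^ (p - 1) = a ^ (p - 2) * a := by
      rw [← Real.rpow_add_one ha.ne']; congr 1; ring
    rw [h4] at h3
    have h5 := mul_le_mul_of_nonneg_left h2 (by linarith : 0 ≤ p)
    nlinarith

lemma wm_step {Ω : Type*} {m m0 : MeasurableSpace Ω} (μ : Measure Ω) [IsProbabilityMeasure μ]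
    (hm : m ≤ m0) {E : Type*} [NormedAddCommGroup E] [InnerProductSpace ℝ E] [CompleteSpace E]
    [MeasurableSpace E] [BorelSpace E] [SecondCountableTopology E]
    {p : ℝ} (hp1 : 1 < p) (hp2 : p ≤ 2) {S X : Ω → E} (hS : Measurable[m] S)
    (hSp : MemLp S (ENNReal.ofReal p) μ) (hXp : MemLp X (ENNReal.ofReal p) μ)
    (hX : μ[X | m] =ᵐ[μ] 0) :
    ∫ ω, ‖S ω + X ω‖ ^ p ∂μ ≤ ∫ ω, ‖S ω‖ ^ p ∂μ + 2 ^ (2 - p) * ∫ ω, ‖X ω‖ ^ p ∂μ := by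
  have hp0 : 0 < p := by linarith
  have htr : (ENNReal.ofReal p).toReal = p := ENNReal.toReal_ofReal hp0.le
  have hone : (1 : ℝ≥0∞) ≤ ENNReal.ofReal p := by
    rw [← ENNReal.ofReal_one]; exact ENNReal.ofReal_le_ofReal hp1.le
  have hint : ∀ {Y : Ω → E}, MemLp Y (ENNReal.ofReal p) μ →
      Integrable (fun ω => ‖Y ω‖ ^ p) μ := fun {Y} hY => by
    have := hY.integrable_norm_rpow (by simpa using hp0) ENNReal.ofReal_ne_top
    rwa [htr] at this
  have iS := hint hSp
  have iX := hint hXp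
  have iSX : Integrable (fun ω => ‖S ω + X ω‖ ^ p) μ := hint (hSp.add hXp)
  let g : Ω → E := fun ω => ‖S ω‖ ^ (p - 2) • S ω
  have hg : StronglyMeasurable[m] g := by
    have : Measurable (fun x : E => ‖x‖ ^ (p - 2) • x) :=
      (measurable_norm.pow_const _).smul measurable_id
    exact (this.comp hS).stronglyMeasurable
  have hgn : ∀ ω, ‖g ω‖ ≤ ‖S ω‖ ^ (p - 1) := fun ω => by
    simp only [g, norm_smul, Real.norm_eq_abs]
    rw [abs_of_nonneg (by positivity)]
    rcases (norm_nonneg (S ω)).eq_or_lt with h | h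
    · rw [← h, mul_zero]; positivity
    · rw [← Real.rpow_add_one h.ne']; apply le_of_eq; congr 1; ring
  have iXX : Integrable X μ := hXp.integrable hone
  have iin : Integrable (fun ω => inner ℝ (g ω) (X ω)) μ := by
    refine (iS.add iX).mono' ((hg.mono hm).aestronglyMeasurable.inner iXX.1) (ae_of_all _ ?_)
    intro ω
    refine (norm_inner_le_norm _ _).trans ?_
    refine (mul_le_mul_of_nonneg_right (hgn ω) (norm_nonneg _)).trans ?_
    have hs := norm_nonneg (S ω)
    have hx := norm_nonneg (X ω)
    simp only [Pi.add_apply]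
    have e : ∀ z : ℝ, 0 ≤ z → z ^ (p - 1) * z = z ^ p := fun z hz => by
      rw [← Real.rpow_add_one' hz (by linarith)]; congr 1; ring
    have hs2 : 0 ≤ ‖S ω‖ ^ p := by positivity
    have hx2 : 0 ≤ ‖X ω‖ ^ p := by positivity
    rcases le_total ‖S ω‖ ‖X ω‖ with h | h
    · have : ‖S ω‖ ^ (p - 1) * ‖X ω‖ ≤ ‖X ω‖ ^ (p - 1) * ‖X ω‖ := by
        gcongr
      rw [e _ hx] at this; linarith
    · have : ‖S ω‖ ^ (p - 1) * ‖X ω‖ ≤ ‖S ω‖ ^ (p - 1) * ‖S ω‖ := by gcongr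
      rw [e _ hs] at this; linarith
  have hz : ∫ ω, inner ℝ (g ω) (X ω) ∂μ = 0 := by
    have h : μ[fun ω => inner ℝ (g ω) (X ω) | m] =ᵐ[μ] fun ω => inner ℝ (g ω) (μ[X | m] ω) :=
      condExp_bilin_of_stronglyMeasurable_left (innerSL ℝ) hg iin iXX
    rw [← integral_condExp hm]
    refine integral_eq_zero_of_ae ?_
    filter_upwards [h, hX] with ω h1 h2
    rw [h1, h2]; simp
  calc ∫ ω, ‖S ω + X ω‖ ^ p ∂μ
      ≤ ∫ ω, (‖S ω‖ ^ p + p * inner ℝ (g ω) (X ω) + 2 ^ (2 - p) * ‖X ω‖ ^ p) ∂μ :=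
        integral_mono iSX ((iS.add (iin.const_mul p)).add (iX.const_mul _))
          (fun ω => wm_pointwise (S ω) (X ω) hp1 hp2)
    _ = _ := by
        have i2 : Integrable (fun ω => ‖S ω‖ ^ p + p * inner ℝ (g ω) (X ω)) μ :=
          iS.add (iin.const_mul p)
        rw [integral_add i2 (iX.const_mul _),
          integral_add iS (iin.const_mul p), integral_const_mul, integral_const_mul, hz]
        simp

/-- Bound on the expected norm of a geometrically weighted sum of a
martingale difference sequence with bounded `p`-th moments. -/
theorem weighted_mds_norm_bound
    {Ω : Type*} [m0 : MeasurableSpace Ω] (μ : Measure Ω) [IsProbabilityMeasure μ]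
    (d : ℕ) (θ p σ : ℝ) (hθ0 : 0 < θ) (hθ1 : θ < 1)
    (hp1 : 1 < p) (hp2 : p ≤ 2) (hσ : 0 ≤ σ)
    (k : ℕ) (δ : ℕ → Ω → EuclideanSpace ℝ (Fin d))
    (hmeas : ∀ t ∈ Finset.Icc 1 k, Measurable (δ t))
    (hmom : ∀ t ∈ Finset.Icc 1 k,
      ∫⁻ ω, (‖δ t ω‖₊ : ℝ≥0∞) ^ p ∂μ ≤ ENNReal.ofReal (σ ^ p))
    (hcond : ∀ t ∈ Finset.Icc 1 k,
      μ[δ t | ⨆ i ∈ Finset.Ico 1 t, MeasurableSpace.comap (δ i) inferInstance]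
        =ᵐ[μ] 0) :
    ∫ ω, ‖∑ t ∈ Finset.Icc 1 k, θ ^ (k - t) • δ t ω‖ ∂μ
      ≤ (2 : ℝ) ^ (2 / p - 1) * σ / (1 - θ ^ p) ^ (1 / p) := by
  have hp0 : 0 < p := by linarith
  have htr : (ENNReal.ofReal p).toReal = p := ENNReal.toReal_ofReal hp0.le
  have hone : (1 : ℝ≥0∞) ≤ ENNReal.ofReal p := by
    rw [← ENNReal.ofReal_one]; exact ENNReal.ofReal_le_ofReal hp1.le
  have hδp : ∀ t ∈ Finset.Icc 1 k, MemLp (δ t) (ENNReal.ofReal p) μ := fun t ht => by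
    refine ⟨(hmeas t ht).aestronglyMeasurable, ?_⟩
    rw [eLpNorm_lt_top_iff_lintegral_rpow_enorm_lt_top (by simpa using hp0) ENNReal.ofReal_ne_top,
      htr]
    exact (hmom t ht).trans_lt ENNReal.ofReal_lt_top
  have hδi : ∀ t ∈ Finset.Icc 1 k, ∫ ω, ‖δ t ω‖ ^ p ∂μ ≤ σ ^ p := fun t ht => by
    rw [integral_eq_lintegral_of_nonneg_ae (ae_of_all _ fun ω => by positivity)
      ((hmeas t ht).norm.pow_const p).aestronglyMeasurable]
    refine ENNReal.toReal_le_of_le_ofReal (by positivity) ?_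
    refine le_trans (le_of_eq ?_) (hmom t ht)
    refine lintegral_congr fun ω => ?_
    rw [← ENNReal.ofReal_rpow_of_nonneg (norm_nonneg _) hp0.le, ofReal_norm]
    rfl
  have main : ∀ n ≤ k, MemLp (fun ω => ∑ t ∈ Finset.Icc 1 n, θ ^ (k - t) • δ t ω)
        (ENNReal.ofReal p) μ ∧
      ∫ ω, ‖∑ t ∈ Finset.Icc 1 n, θ ^ (k - t) • δ t ω‖ ^ p ∂μ
        ≤ 2 ^ (2 - p) * (∑ t ∈ Finset.Icc 1 n, (θ ^ p) ^ (k - t)) * σ ^ p := by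
    intro n
    induction n with
    | zero =>
      intro _
      simp [Real.zero_rpow hp0.ne']
    | succ n ih =>
      intro hn
      obtain ⟨ih1, ih2⟩ := ih (by omega)
      have hmem : n + 1 ∈ Finset.Icc 1 k := by simp; omega
      have hX : MemLp (fun ω => θ ^ (k - (n + 1)) • δ (n + 1) ω) (ENNReal.ofReal p) μ :=
        (hδp _ hmem).const_smul (θ ^ (k - (n + 1)))
      simp only [Finset.sum_Icc_succ_top (Nat.le_add_left 1 n)]
      refine ⟨ih1.add hX, ?_⟩
      have hm : (⨆ i ∈ Finset.Ico 1 (n + 1), MeasurableSpace.comap (δ i) inferInstance) ≤ m0 := by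
        refine iSup₂_le fun i hi => (hmeas i ?_).comap_le
        simp at hi ⊢; omega
      have hS : Measurable[⨆ i ∈ Finset.Ico 1 (n + 1),
          MeasurableSpace.comap (δ i) inferInstance]
          (fun ω => ∑ t ∈ Finset.Icc 1 n, θ ^ (k - t) • δ t ω) := by
        refine Finset.measurable_fun_sum _ fun i hi => ?_
        suffices hi' : Measurable[⨆ i ∈ Finset.Ico 1 (n + 1),
            MeasurableSpace.comap (δ i) inferInstance] (δ i) from hi'.const_smul (θ ^ (k - i))
        refine Measurable.mono (comap_measurable (δ i)) ?_ le_rfl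
        refine le_iSup₂_of_le i ?_ le_rfl
        simp at hi ⊢; omega
      have hc : μ[fun ω => θ ^ (k - (n + 1)) • δ (n + 1) ω |
          ⨆ i ∈ Finset.Ico 1 (n + 1), MeasurableSpace.comap (δ i) inferInstance] =ᵐ[μ] 0 := by
        refine (condExp_smul (θ ^ (k - (n + 1))) (δ (n + 1)) _).trans ?_
        filter_upwards [hcond _ hmem] with ω h
        rw [Pi.smul_apply, h, Pi.zero_apply, smul_zero]
      have h := wm_step μ hm hp1 hp2 hS ih1 hX hc
      refine h.trans ?_
      have e : ∫ ω, ‖θ ^ (k - (n + 1)) • δ (n + 1) ω‖ ^ p ∂μ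
          ≤ (θ ^ p) ^ (k - (n + 1)) * σ ^ p := by
        have : ∀ ω, ‖θ ^ (k - (n + 1)) • δ (n + 1) ω‖ ^ p
            = (θ ^ p) ^ (k - (n + 1)) * ‖δ (n + 1) ω‖ ^ p := fun ω => by
          rw [norm_smul, Real.norm_of_nonneg (by positivity),
            Real.mul_rpow (by positivity) (norm_nonneg _), Real.rpow_pow_comm hθ0.le]
        simp only [this]
        rw [integral_const_mul]
        exact mul_le_mul_of_nonneg_left (hδi _ hmem) (by positivity)
      have e2 := mul_le_mul_of_nonneg_left e (by positivity : (0:ℝ) ≤ 2 ^ (2 - p))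
      linarith
  obtain ⟨h1, h2⟩ := main k le_rfl
  have hr1 : θ ^ p < 1 := Real.rpow_lt_one hθ0.le hθ1 hp0
  have hr0 : 0 < θ ^ p := Real.rpow_pos_of_pos hθ0 p
  have hgeo : ∑ t ∈ Finset.Icc 1 k, (θ ^ p) ^ (k - t) ≤ (1 - θ ^ p)⁻¹ := by
    have e : ∑ t ∈ Finset.Icc 1 k, (θ ^ p) ^ (k - t) = ∑ j ∈ Finset.range k, (θ ^ p) ^ j := by
      refine Finset.sum_bij' (fun t _ => k - t) (fun j _ => k - j) ?_ ?_ ?_ ?_ ?_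
      all_goals intro a ha
      all_goals simp at ha ⊢
      all_goals omega
    rw [e, ← tsum_geometric_of_lt_one hr0.le hr1]
    exact (summable_geometric_of_lt_one hr0.le hr1).sum_le_tsum _ (fun _ _ => by positivity)
  set S : Ω → EuclideanSpace ℝ (Fin d) := fun ω => ∑ t ∈ Finset.Icc 1 k, θ ^ (k - t) • δ t ω
  have iS : Integrable (fun ω => ‖S ω‖ ^ p) μ := by
    have := h1.integrable_norm_rpow (by simpa using hp0) ENNReal.ofReal_ne_top
    rwa [htr] at this
  have hJ : (∫ ω, ‖S ω‖ ∂μ) ^ p ≤ ∫ ω, ‖S ω‖ ^ p ∂μ :=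
    (convexOn_rpow hp1.le).map_integral_le
      (Real.continuous_rpow_const hp0.le).continuousOn isClosed_Ici
      (ae_of_all _ fun ω => norm_nonneg (S ω)) (h1.integrable hone).norm iS
  have hB : (∫ ω, ‖S ω‖ ∂μ) ^ p ≤ 2 ^ (2 - p) * (1 - θ ^ p)⁻¹ * σ ^ p := by
    refine (hJ.trans h2).trans ?_
    gcongr
  have hpos : 0 < 1 - θ ^ p := by linarith
  have hfin : ((2 : ℝ) ^ (2 / p - 1) * σ / (1 - θ ^ p) ^ (1 / p)) ^ p
      = 2 ^ (2 - p) * (1 - θ ^ p)⁻¹ * σ ^ p := by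
    rw [Real.div_rpow (by positivity) (by positivity), Real.mul_rpow (by positivity) hσ,
      ← Real.rpow_mul (by norm_num), ← Real.rpow_mul hpos.le, one_div_mul_cancel hp0.ne',
      Real.rpow_one, show (2 / p - 1) * p = 2 - p by field_simp]
    ring
  rw [← hfin] at hB
  exact (Real.rpow_le_rpow_iff (integral_nonneg fun ω => norm_nonneg _) (by positivity) hp0).1 hB
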